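/- Let G₁, G, H be groups of nilpotence class two and let g : G₁ → G and f : G → H be q-maps. Then the composite f∘g : G₁ → H is a q-map, and its cross-effect is given by (a|b)_{f∘g} = f((a|b)_g)·(g(a)|g(b))_f for all a, b ∈ G₁. -/

import Mathlib

/-- The cross-effect of a map between groups: `(a|b)_f = (f a * f b)⁻¹ * f (a*b)`. -/
def crossEff {G H : Type*} [Group G] [Group H] (f : G → H) (a b : G) : H :=
  (f a * f b)⁻¹ * f (a * b)

/-- The commutator `[a,b] = a⁻¹ * b⁻¹ * a * b`. -/
def cmt {G : Type*} [Group G] (a b : G) : G := a⁻¹ * b⁻¹ * a * b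

/-- A map between groups is weakly quadratic if its cross-effect commutes with all values
of `f` and is multiplicative in each variable. -/
def IsWeaklyQuadratic {G H : Type*} [Group G] [Group H] (f : G → H) : Prop :=
  (∀ a b c : G, Commute (crossEff f a b) (f c)) ∧
  (∀ a a' b : G, crossEff f (a * a') b = crossEff f a b * crossEff f a' b) ∧
  (∀ a b b' : G, crossEff f a (b * b') = crossEff f a b * crossEff f a b')

/-- A quadratic map: weakly quadratic with central cross-effect values. -/
def IsQuadratic {G H : Type*} [Group G] [Group H] (f : G → H) : Prop :=
  IsWeaklyQuadratic f ∧ ∀ a b : G, crossEff f a b ∈ Subgroup.center H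

/-- A q-map: weakly quadratic with cross-effect values in the commutator subgroup. -/
def IsQMap {G H : Type*} [Group G] [Group H] (f : G → H) : Prop :=
  IsWeaklyQuadratic f ∧ ∀ a b : G, crossEff f a b ∈ commutator H

/-- A homomorphism with central values is trivial on the commutator subgroup. -/
theorem eq_one_of_mem_commutator {G H : Type*} [Group G] [Group H] (φ : G →* H)
    (hφ : ∀ a, φ a ∈ Subgroup.center H) {z : G} (hz : z ∈ commutator G) : φ z = 1 := by
  rw [commutator_def] at hz
  have hle : ⁅(⊤ : Subgroup G), ⊤⁆ ≤ φ.ker := by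
    rw [Subgroup.commutator_le]
    intro a _ b _
    rw [MonoidHom.mem_ker, map_commutatorElement, commutatorElement_eq_one_iff_mul_comm]
    exact (Subgroup.mem_center_iff.mp (hφ a) _).symm
  exact hle hz

theorem apply_mul_eq_mul_crossEff {G H : Type*} [Group G] [Group H] (f : G → H) (a b : G) :
    f (a * b) = f a * f b * crossEff f a b := by
  simp [crossEff, mul_assoc]

namespace IsQMap

variable {G H : Type*} [Group G] [Group H] {f : G → H}

theorem crossEff_of_mem_left (hH : commutator H ≤ Subgroup.center H) (hf : IsQMap f)
    {z : G} (hz : z ∈ commutator G) (b : G) : crossEff f z b = 1 :=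
  eq_one_of_mem_commutator
    (MonoidHom.mk' (fun a => crossEff f a b) fun a a' => hf.1.2.1 a a' b)
    (fun a => hH (hf.2 a b)) hz

theorem crossEff_of_mem_right (hH : commutator H ≤ Subgroup.center H) (hf : IsQMap f)
    (a : G) {z : G} (hz : z ∈ commutator G) : crossEff f a z = 1 :=
  eq_one_of_mem_commutator
    (MonoidHom.mk' (fun b => crossEff f a b) fun b b' => hf.1.2.2 a b b')
    (fun b => hH (hf.2 a b)) hz

theorem apply_mul_of_mem_right (hH : commutator H ≤ Subgroup.center H) (hf : IsQMap f)
    (a : G) {z : G} (hz : z ∈ commutator G) : f (a * z) = f a * f z := by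
  rw [apply_mul_eq_mul_crossEff f, crossEff_of_mem_right hH hf a hz, mul_one]

/-- A q-map sends commutators to commutators. -/
theorem apply_mem_commutator (hf : IsQMap f)
    {z : G} (hz : z ∈ commutator G) : f z ∈ commutator H := by
  have hker {x : H} : x ∈ commutator H ↔ Abelianization.of x = 1 := by
    rw [← MonoidHom.mem_ker, Abelianization.ker_of]
  have hof (a b : G) : Abelianization.of (f (a * b)) =
      Abelianization.of (f a) * Abelianization.of (f b) := by
    rw [apply_mul_eq_mul_crossEff f, map_mul, hker.mp (hf.2 a b), mul_one, map_mul]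
  let φ : G →* Abelianization H := MonoidHom.mk' (fun a => Abelianization.of (f a)) hof
  exact hker.mpr (Abelianization.commutator_subset_ker φ hz)

theorem crossEff_apply_mul_left (hH : commutator H ≤ Subgroup.center H) (hf : IsQMap f)
    {K : Type*} [Group K] {g : K → G} (hg : IsQMap g) (a a' : K) (x : G) :
    crossEff f (g (a * a')) x = crossEff f (g a) x * crossEff f (g a') x := by
  rw [apply_mul_eq_mul_crossEff g, hf.1.2.1, hf.1.2.1,
    crossEff_of_mem_left hH hf (hg.2 a a'), mul_one]

theorem crossEff_apply_mul_right (hH : commutator H ≤ Subgroup.center H) (hf : IsQMap f)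
    {K : Type*} [Group K] {g : K → G} (hg : IsQMap g) (x : G) (b b' : K) :
    crossEff f x (g (b * b')) = crossEff f x (g b) * crossEff f x (g b') := by
  rw [apply_mul_eq_mul_crossEff g, hf.1.2.2, hf.1.2.2,
    crossEff_of_mem_right hH hf x (hg.2 b b'), mul_one]

/-- The cross-effect of a composite of q-maps. -/
theorem crossEff_comp (hH : commutator H ≤ Subgroup.center H) (hf : IsQMap f)
    {K : Type*} [Group K] {g : K → G} (hg : IsQMap g) (a b : K) :
    crossEff (f ∘ g) a b = f (crossEff g a b) * crossEff f (g a) (g b) := by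
  rw [Subgroup.mem_center_iff.mp (hH (hf.2 (g a) (g b)))]
  change (f (g a) * f (g b))⁻¹ * f (g (a * b)) = _
  rw [apply_mul_eq_mul_crossEff g, apply_mul_of_mem_right hH hf _ (hg.2 a b),
    apply_mul_eq_mul_crossEff f (g a)]
  group

end IsQMap

theorem stmt_12 {G₁ G H : Type*} [Group G₁] [Group G] [Group H]
    (hG₁ : commutator G₁ ≤ Subgroup.center G₁) (hG : commutator G ≤ Subgroup.center G)
    (hH : commutator H ≤ Subgroup.center H)
    (g : G₁ → G) (f : G → H) (hg : IsQMap g) (hf : IsQMap f) :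
    IsQMap (f ∘ g) ∧
    (∀ a b : G₁, crossEff (f ∘ g) a b = f (crossEff g a b) * crossEff f (g a) (g b)) := by
  have hcomp := IsQMap.crossEff_comp hH hf hg
  have hmem (a b : G₁) : crossEff (f ∘ g) a b ∈ commutator H := by
    rw [hcomp]
    exact mul_mem (hf.apply_mem_commutator (hg.2 a b)) (hf.2 _ _)
  have hcomm (a b : G) (h : H) : crossEff f a b * h = h * crossEff f a b :=
    (Subgroup.mem_center_iff.mp (hH (hf.2 a b)) h).symm
  refine ⟨⟨⟨fun a b c => (Subgroup.mem_center_iff.mp (hH (hmem a b)) _).symm, ?_, ?_⟩, hmem⟩,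
    hcomp⟩
  · intro a a' b
    rw [hcomp, hcomp, hcomp, hg.1.2.1, hf.apply_mul_of_mem_right hH _ (hg.2 a' b),
      hf.crossEff_apply_mul_left hH hg, mul_assoc, mul_assoc,
      hcomm (g a) (g b) (f _ * _), mul_assoc, hcomm (g a) (g b)]
  · intro a b b'
    rw [hcomp, hcomp, hcomp, hg.1.2.2, hf.apply_mul_of_mem_right hH _ (hg.2 a b'),
      hf.crossEff_apply_mul_right hH hg, mul_assoc, mul_assoc, hcomm (g a) (g b) (f _ * _),
      mul_assoc, hcomm (g a) (g b)]
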